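/- arXiv:1711.05096 — 7 statements merged into one kernel-verified Lean document; each statement's English description precedes it below -/
import Mathlib

section
/- For every positive integer n there exists a finite simple graph G on 2n vertices such that G admits an axis-aligned 2-bend EPG representation and G has at least 2^n maximal cliques. (In other words, 2-bend EPG graphs can have exponentially many maximal cliques.) -/
open Set

/-- Two points span an axis-parallel segment (same x or same y). -/
def AxisParallel (p q : ℝ × ℝ) : Prop := p.1 = q.1 ∨ p.2 = q.2

/-- Segment `p q` and segment `q r` are axis-parallel and mutually perpendicular. -/
def Perp (p q r : ℝ × ℝ) : Prop :=
  (p.1 = q.1 ∧ q.2 = r.2) ∨ (p.2 = q.2 ∧ q.1 = r.1)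

/-- An axis-aligned 2-bend path: a union of at most three closed segments of positive
length, each axis-parallel, consecutive ones sharing an endpoint and perpendicular. -/
def IsAA2BendPath (P : Set (ℝ × ℝ)) : Prop :=
  (∃ p q : ℝ × ℝ, p ≠ q ∧ AxisParallel p q ∧ P = segment ℝ p q) ∨
  (∃ p q r : ℝ × ℝ, p ≠ q ∧ q ≠ r ∧ Perp p q r ∧
    P = segment ℝ p q ∪ segment ℝ q r) ∨
  (∃ p q r s : ℝ × ℝ, p ≠ q ∧ q ≠ r ∧ r ≠ s ∧ Perp p q r ∧ Perp q r s ∧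
    P = segment ℝ p q ∪ segment ℝ q r ∪ segment ℝ r s)

/-- An axis-aligned 2-bend EPG representation of a graph. -/
def IsAA2BendEPG {V : Type*} (G : SimpleGraph V) (f : V → Set (ℝ × ℝ)) : Prop :=
  (∀ v, IsAA2BendPath (f v)) ∧
  ∀ u v : V, u ≠ v → (G.Adj u v ↔ (f u ∩ f v).Infinite)

/-- A maximal clique of a graph. -/
def MaximalClique {V : Type*} (G : SimpleGraph V) (s : Set V) : Prop :=
  G.IsClique s ∧ ∀ t : Set V, G.IsClique t → s ⊆ t → t = s

lemma mem_hseg (a b y : ℝ) (h : a ≤ b) (p : ℝ × ℝ) :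
    p ∈ segment ℝ (a, y) (b, y) ↔ p.2 = y ∧ a ≤ p.1 ∧ p.1 ≤ b := by
  rw [← Prod.image_mk_segment_left, segment_eq_Icc h]
  obtain ⟨u, v⟩ := p
  simp only [mem_image, mem_Icc, Prod.mk.injEq]
  constructor
  · rintro ⟨x, hx, rfl, rfl⟩
    exact ⟨rfl, hx⟩
  · rintro ⟨rfl, hx⟩
    exact ⟨u, hx, rfl, rfl⟩

lemma mem_vseg (a b x : ℝ) (h : a ≤ b) (p : ℝ × ℝ) :
    p ∈ segment ℝ (x, a) (x, b) ↔ p.1 = x ∧ a ≤ p.2 ∧ p.2 ≤ b := by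
  rw [← Prod.image_mk_segment_right, segment_eq_Icc h]
  obtain ⟨u, v⟩ := p
  simp only [mem_image, mem_Icc, Prod.mk.injEq]
  constructor
  · rintro ⟨x, hx, rfl, rfl⟩
    exact ⟨rfl, hx⟩
  · rintro ⟨rfl, hx⟩
    exact ⟨v, hx, rfl, rfl⟩

/-- The U-shaped path with vertical part at abscissa `N`, and ends `(t, 0)`, `(-t, 1)`. -/
def uPath (N t : ℝ) : Set (ℝ × ℝ) :=
  segment ℝ (t, 0) (N, 0) ∪ segment ℝ (N, 0) (N, 1) ∪ segment ℝ (N, 1) (-t, 1)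

lemma uPath_isPath (N t : ℝ) (h1 : t ≠ N) (h2 : N ≠ -t) : IsAA2BendPath (uPath N t) := by
  refine Or.inr (Or.inr ⟨(t, 0), (N, 0), (N, 1), (-t, 1), ?_, ?_, ?_, ?_, ?_, rfl⟩)
  · simpa using h1
  · simp
  · simpa using h2
  · exact Or.inr ⟨rfl, rfl⟩
  · exact Or.inl ⟨rfl, rfl⟩

lemma mem_uPath_right (N t : ℝ) (h1 : t < N) (h2 : -t < N) (p : ℝ × ℝ) :
    p ∈ uPath N t ↔ (p.2 = 0 ∧ t ≤ p.1 ∧ p.1 ≤ N) ∨ (p.1 = N ∧ 0 ≤ p.2 ∧ p.2 ≤ 1) ∨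
      (p.2 = 1 ∧ -t ≤ p.1 ∧ p.1 ≤ N) := by
  unfold uPath
  rw [segment_symm ℝ (N, (1 : ℝ)), mem_union, mem_union, mem_hseg _ _ _ h1.le, mem_hseg _ _ _ h2.le,
    mem_vseg _ _ _ zero_le_one, or_assoc]

lemma mem_uPath_left (N t : ℝ) (h1 : t < N) (h2 : -t < N) (p : ℝ × ℝ) :
    p ∈ uPath (-N) t ↔ (p.2 = 0 ∧ -N ≤ p.1 ∧ p.1 ≤ t) ∨ (p.1 = -N ∧ 0 ≤ p.2 ∧ p.2 ≤ 1) ∨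
      (p.2 = 1 ∧ -N ≤ p.1 ∧ p.1 ≤ -t) := by
  unfold uPath
  rw [segment_symm ℝ (t, (0 : ℝ)), mem_union, mem_union, mem_hseg _ _ _ (by linarith),
    mem_hseg _ _ _ (by linarith), mem_vseg _ _ _ zero_le_one, or_assoc]

lemma inf_h (s : Set (ℝ × ℝ)) (a b y : ℝ) (h : a < b)
    (hs : ∀ x, a ≤ x → x ≤ b → (x, y) ∈ s) : s.Infinite := by
  refine Infinite.mono ?_ ((Icc_infinite h).image (f := fun x => (x, y)) ?_)
  · rintro _ ⟨x, hx, rfl⟩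
    exact hs x hx.1 hx.2
  · intro u _ v _ huv
    simpa using huv

/-- Two U-paths sharing the vertical line have infinite intersection. -/
lemma same_inf (N t t' : ℝ) : (uPath N t ∩ uPath N t').Infinite := by
  refine Infinite.mono ?_ ((Icc_infinite (zero_lt_one' ℝ)).image (f := fun x => (N, x)) ?_)
  · rintro _ ⟨x, hx, rfl⟩
    have : (N, x) ∈ segment ℝ (N, (0 : ℝ)) (N, 1) := by
      rw [mem_vseg _ _ _ zero_le_one]
      exact ⟨rfl, hx⟩
    exact ⟨Or.inl (Or.inr this), Or.inl (Or.inr this)⟩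
  · intro u _ v _ huv
    simpa using huv

lemma opp_inf (N t t' : ℝ) (h1 : t < N) (h2 : -t < N) (h1' : t' < N) (h2' : -t' < N) :
    (uPath (-N) t ∩ uPath N t').Infinite ↔ t ≠ t' := by
  constructor
  · rintro h rfl
    apply h
    refine Finite.subset (s := {(t, (0 : ℝ)), (-t, (1 : ℝ))}) (by simp) ?_
    rintro ⟨x, y⟩ ⟨ha, hb⟩
    rw [mem_uPath_left N t h1 h2] at ha
    rw [mem_uPath_right N t h1 h2] at hb
    simp only [mem_insert_iff, mem_singleton_iff, Prod.mk.injEq] at *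
    rcases ha with ⟨a1, a2, a3⟩ | ⟨a1, a2, a3⟩ | ⟨a1, a2, a3⟩ <;>
    rcases hb with ⟨b1, b2, b3⟩ | ⟨b1, b2, b3⟩ | ⟨b1, b2, b3⟩ <;>
    first
    | (exfalso; linarith)
    | (left; constructor <;> linarith)
    | (right; constructor <;> linarith)
  · intro h
    rcases lt_or_gt_of_ne h with h | h
    · refine inf_h _ (-t') (-t) 1 (by linarith) ?_
      intro x hx hx'
      constructor
      · rw [mem_uPath_left N t h1 h2]
        exact Or.inr (Or.inr ⟨rfl, by simp only; linarith, hx'⟩)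
      · rw [mem_uPath_right N t' h1' h2']
        exact Or.inr (Or.inr ⟨rfl, hx, by simp only; linarith⟩)
    · refine inf_h _ t' t 0 h ?_
      intro x hx hx'
      constructor
      · rw [mem_uPath_left N t h1 h2]
        exact Or.inl ⟨rfl, by simp only; linarith, hx'⟩
      · rw [mem_uPath_right N t' h1' h2']
        exact Or.inl ⟨rfl, hx, by simp only; linarith⟩

/-- 2-bend EPG graphs can have exponentially many maximal cliques: for every positive
integer `n` there is a graph on `2*n` vertices admitting an axis-aligned 2-bend EPG
representation and having at least `2^n` maximal cliques. -/
theorem stmt0 (n : ℕ) (hn : 0 < n) :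
    ∃ (G : SimpleGraph (Fin (2 * n))) (f : Fin (2 * n) → Set (ℝ × ℝ)),
      IsAA2BendEPG G f ∧
      2 ^ n ≤ {s : Set (Fin (2 * n)) | MaximalClique G s}.ncard := by
  obtain ⟨e⟩ : Nonempty (Fin (2 * n) ≃ Bool × Fin n) :=
    ⟨Fintype.equivOfCardEq (by simp)⟩
  let G : SimpleGraph (Fin (2 * n)) :=
    { Adj := fun u v => (e u).2 ≠ (e v).2
      symm := ⟨fun u v h => Ne.symm h⟩
      loopless := ⟨fun u h => h rfl⟩ }
  have hG : ∀ u v, G.Adj u v ↔ (e u).2 ≠ (e v).2 := fun u v => Iff.rfl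
  have hlt : ∀ i : Fin n, ((i : ℕ) : ℝ) < n := fun i => by exact_mod_cast i.2
  have hlt' : ∀ i : Fin n, -((i : ℕ) : ℝ) < n := fun i => by
    have := hlt i
    have h0 : (0 : ℝ) ≤ ((i : ℕ) : ℝ) := Nat.cast_nonneg _
    linarith
  have hinj : ∀ i j : Fin n, ((i : ℕ) : ℝ) ≠ ((j : ℕ) : ℝ) ↔ i ≠ j := fun i j => by
    rw [Ne, Nat.cast_inj, Fin.val_inj]
  let F : Bool × Fin n → Set (ℝ × ℝ) := fun x =>
    uPath (if x.1 then (n : ℝ) else -(n : ℝ)) ((x.2 : ℕ) : ℝ)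
  refine ⟨G, fun v => F (e v), ⟨?_, ?_⟩, ?_⟩
  · intro v
    have h1 := hlt (e v).2
    have h2 := hlt' (e v).2
    apply uPath_isPath
    · split_ifs
      · exact h1.ne
      · intro h; linarith
    · split_ifs
      · exact h2.ne'
      · intro h; linarith
  · intro u v huv
    rw [hG]
    change (e u).2 ≠ (e v).2 ↔ (F (e u) ∩ F (e v)).Infinite
    have hne : e u ≠ e v := fun h => huv (e.injective h)
    generalize e u = x at *
    generalize e v = y at *
    obtain ⟨b, i⟩ := x
    obtain ⟨c, j⟩ := y
    have key : (uPath (-(n : ℝ)) ((i : ℕ) : ℝ) ∩ uPath n ((j : ℕ) : ℝ)).Infinite ↔ i ≠ j := by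
      rw [opp_inf _ _ _ (hlt i) (hlt' i) (hlt j) (hlt' j), hinj]
    have key' : (uPath (-(n : ℝ)) ((j : ℕ) : ℝ) ∩ uPath n ((i : ℕ) : ℝ)).Infinite ↔ j ≠ i := by
      rw [opp_inf _ _ _ (hlt j) (hlt' j) (hlt i) (hlt' i), hinj]
    have hF : ∀ k, F (false, k) = uPath (-(n : ℝ)) ((k : ℕ) : ℝ) := fun k => by simp [F]
    have hT : ∀ k, F (true, k) = uPath (n : ℝ) ((k : ℕ) : ℝ) := fun k => by simp [F]
    clear_value F
    cases b <;> cases c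
    · have hij : i ≠ j := fun h => hne (by rw [h])
      rw [hF, hF]
      exact iff_of_true hij (same_inf _ _ _)
    · rw [hF, hT]
      exact key.symm
    · rw [hF, hT, inter_comm]
      exact ne_comm.trans key'.symm
    · have hij : i ≠ j := fun h => hne (by rw [h])
      rw [hT, hT]
      exact iff_of_true hij (same_inf _ _ _)
  · let S : (Fin n → Bool) → Set (Fin (2 * n)) := fun c => {v | (e v).1 = c (e v).2}
    have hS : Function.Injective S := by
      intro c d h
      funext i
      have h1 : e.symm (c i, i) ∈ S c := by simp [S]
      rw [h] at h1
      simpa [S] using h1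
    have hsub : range S ⊆ {s : Set (Fin (2 * n)) | MaximalClique G s} := by
      rintro _ ⟨c, rfl⟩
      refine ⟨?_, ?_⟩
      · intro u hu v hv huv h
        apply huv
        apply e.injective
        have hu' : (e u).1 = c (e u).2 := hu
        have hv' : (e v).1 = c (e v).2 := hv
        exact Prod.ext (by rw [hu', hv', h]) h
      · intro t ht hst
        refine Subset.antisymm ?_ hst
        intro v hv
        have hw : e.symm (c (e v).2, (e v).2) ∈ t := hst (by simp [S])
        by_cases hvw : v = e.symm (c (e v).2, (e v).2)
        · have h2 := congrArg e hvw
          rw [e.apply_symm_apply] at h2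
          exact congrArg Prod.fst h2
        · have h3 := ht hv hw hvw
          rw [hG] at h3
          simp at h3
    calc 2 ^ n = Nat.card (Fin n → Bool) := by simp
      _ = (range S).ncard := by
        rw [← image_univ, ncard_image_of_injective _ hS, ncard_univ]
      _ ≤ _ := ncard_le_ncard hsub (toFinite _)
end

section
/- Let P be an axis-aligned 2-bend path and let t₁, t₂, t₃ be closed horizontal segments of positive length lying on three pairwise distinct horizontal lines. Then it is not the case that P ∩ tᵢ is infinite for all i ∈ {1,2,3}; i.e., a 2-bend path cannot be adjacent to three parallel, pairwise non-collinear segments. -/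
open Set

/-- A closed horizontal segment of positive length lying on the horizontal line `y`. -/
def IsHorizSegOn (t : Set (ℝ × ℝ)) (y : ℝ) : Prop :=
  ∃ p q : ℝ × ℝ, p ≠ q ∧ p.2 = y ∧ q.2 = y ∧ t = segment ℝ p q

/-- A closed vertical segment of positive length. -/
def IsVertSeg (t : Set (ℝ × ℝ)) : Prop :=
  ∃ p q : ℝ × ℝ, p ≠ q ∧ p.1 = q.1 ∧ t = segment ℝ p q

theorem seg_fst {p q z : ℝ × ℝ} (h : p.1 = q.1) (hz : z ∈ segment ℝ p q) : z.1 = p.1 := by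
  obtain ⟨a, b, _, _, hab, rfl⟩ := hz
  simp only [Prod.fst_add, Prod.smul_fst, smul_eq_mul, ← h]
  rw [← add_mul, hab, one_mul]

theorem seg_snd {p q z : ℝ × ℝ} (h : p.2 = q.2) (hz : z ∈ segment ℝ p q) : z.2 = p.2 := by
  obtain ⟨a, b, _, _, hab, rfl⟩ := hz
  simp only [Prod.snd_add, Prod.smul_snd, smul_eq_mul, ← h]
  rw [← add_mul, hab, one_mul]

/-- An axis-parallel segment meeting a horizontal segment infinitely often lies on its line. -/
theorem seg_key {p q : ℝ × ℝ} (h : AxisParallel p q) {t : Set (ℝ × ℝ)} {y : ℝ}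
    (ht : IsHorizSegOn t y) (hi : (segment ℝ p q ∩ t).Infinite) : p.2 = y ∧ q.2 = y := by
  obtain ⟨u, v, _, hu, hv, rfl⟩ := ht
  have hy : ∀ z ∈ segment ℝ u v, z.2 = y := fun z hz =>
    (seg_snd (hu.trans hv.symm) hz).trans hu
  rcases h with h | h
  · exfalso
    apply hi
    apply Set.Subsingleton.finite
    rintro z ⟨hz, hz'⟩ w ⟨hw, hw'⟩
    exact Prod.ext ((seg_fst h hz).trans (seg_fst h hw).symm)
      ((hy z hz').trans (hy w hw').symm)
  · obtain ⟨z, hz, hz'⟩ := hi.nonempty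
    have h1 := seg_snd h hz
    have h2 := hy z hz'
    exact ⟨h1.symm.trans h2, h.symm.trans (h1.symm.trans h2)⟩

theorem perp_left {p q r : ℝ × ℝ} (h : Perp p q r) : AxisParallel p q := by
  rcases h with h | h
  · exact Or.inl h.1
  · exact Or.inr h.1

theorem perp_right {p q r : ℝ × ℝ} (h : Perp p q r) : AxisParallel q r := by
  rcases h with h | h
  · exact Or.inr h.2
  · exact Or.inl h.2

/-- A 2-bend path cannot be adjacent (share infinitely many points) with three
horizontal segments lying on three pairwise distinct horizontal lines. -/
theorem stmt3 (P t1 t2 t3 : Set (ℝ × ℝ)) (hP : IsAA2BendPath P)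
    (y1 y2 y3 : ℝ) (h12 : y1 ≠ y2) (h13 : y1 ≠ y3) (h23 : y2 ≠ y3)
    (ht1 : IsHorizSegOn t1 y1) (ht2 : IsHorizSegOn t2 y2) (ht3 : IsHorizSegOn t3 y3) :
    ¬ ((P ∩ t1).Infinite ∧ (P ∩ t2).Infinite ∧ (P ∩ t3).Infinite) := by
  rintro ⟨i1, i2, i3⟩
  rcases hP with ⟨p, q, _, h, rfl⟩ | ⟨p, q, r, _, _, h, rfl⟩ |
    ⟨p, q, r, s, _, _, _, h, h', rfl⟩
  · have k1 := seg_key h ht1 i1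
    have k2 := seg_key h ht2 i2
    exact h12 (k1.1.symm.trans k2.1)
  · have key : ∀ t y, IsHorizSegOn t y →
        ((segment ℝ p q ∪ segment ℝ q r) ∩ t).Infinite → q.2 = y := by
      intro t y ht hi
      rw [Set.union_inter_distrib_right, Set.infinite_union] at hi
      rcases hi with hi | hi
      · exact (seg_key (perp_left h) ht hi).2
      · exact (seg_key (perp_right h) ht hi).1
    exact h12 ((key _ _ ht1 i1).symm.trans (key _ _ ht2 i2))
  · have key : ∀ t y, IsHorizSegOn t y →
        ((segment ℝ p q ∪ segment ℝ q r ∪ segment ℝ r s) ∩ t).Infinite →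
        q.2 = y ∨ r.2 = y := by
      intro t y ht hi
      rw [Set.union_inter_distrib_right, Set.union_inter_distrib_right,
        Set.infinite_union, Set.infinite_union] at hi
      rcases hi with (hi | hi) | hi
      · exact Or.inl (seg_key (perp_left h) ht hi).2
      · exact Or.inl (seg_key (perp_right h) ht hi).1
      · exact Or.inr (seg_key (perp_right h') ht hi).1
    have k1 := key _ _ ht1 i1
    have k2 := key _ _ ht2 i2
    have k3 := key _ _ ht3 i3
    grind
end

section
/- Let s and t be closed horizontal segments of positive length lying on the same horizontal line with s ∩ t finite. If P and Q are axis-aligned 2-bend paths such that each of P and Q has infinite intersection with each of s and t, then P ∩ Q is infinite. In other words, two collinear segments cannot both be adjacent to two mutually non-adjacent 2-bend paths. -/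
open Set

theorem seg_horiz {p q : ℝ × ℝ} (h : p.2 = q.2) :
    segment ℝ p q = {z | z.2 = p.2 ∧ z.1 ∈ Icc (min p.1 q.1) (max p.1 q.1)} := by
  obtain ⟨a, y⟩ := p
  obtain ⟨b, y'⟩ := q
  simp only at h
  subst h
  rw [← Prod.image_mk_segment_left, segment_eq_uIcc]
  ext ⟨u, v⟩
  simp only [mem_image, Prod.mk.injEq, mem_setOf_eq, uIcc]
  constructor
  · rintro ⟨x, hx, rfl, rfl⟩
    exact ⟨rfl, hx⟩
  · rintro ⟨rfl, hx⟩
    exact ⟨u, hx, rfl, rfl⟩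

def ThinAt (y : ℝ) (S : Set (ℝ × ℝ)) : Prop := (S ∩ {z | z.2 = y}).Finite

def GoodAt (y : ℝ) (S : Set (ℝ × ℝ)) : Prop :=
  ∃ a b : ℝ, (∀ x ∈ Icc a b, (x, y) ∈ S) ∧
    (S ∩ {z | z.2 = y ∧ z.1 ∉ Icc a b}).Finite

theorem thin_good {y : ℝ} {S T : Set (ℝ × ℝ)} (hS : ThinAt y S) (hT : GoodAt y T) :
    GoodAt y (S ∪ T) := by
  obtain ⟨a, b, h1, h2⟩ := hT
  refine ⟨a, b, fun x hx => Or.inr (h1 x hx), (hS.union h2).subset ?_⟩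
  rintro z ⟨hz | hz, hy, hn⟩
  · exact Or.inl ⟨hz, hy⟩
  · exact Or.inr ⟨hz, hy, hn⟩

theorem good_thin {y : ℝ} {S T : Set (ℝ × ℝ)} (hS : GoodAt y S) (hT : ThinAt y T) :
    GoodAt y (S ∪ T) := by
  rw [union_comm]
  exact thin_good hT hS

theorem thin_vert (y : ℝ) {p q : ℝ × ℝ} (h : p.1 = q.1) : ThinAt y (segment ℝ p q) := by
  obtain ⟨a, c⟩ := p
  obtain ⟨b, d⟩ := q
  simp only at h
  subst h
  refine (Set.finite_singleton (a, y)).subset ?_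
  rw [← Prod.image_mk_segment_right]
  rintro z ⟨⟨x, hx, rfl⟩, hz⟩
  simp only [mem_setOf_eq] at hz
  simp [hz]

theorem thin_off {y : ℝ} {p q : ℝ × ℝ} (h : p.2 = q.2) (hy : p.2 ≠ y) :
    ThinAt y (segment ℝ p q) := by
  refine Set.finite_empty.subset ?_
  rw [seg_horiz h]
  rintro z ⟨⟨h1, -⟩, h2⟩
  exact hy (h1.symm.trans h2)

theorem good_seg (y : ℝ) {p q : ℝ × ℝ} (h : AxisParallel p q) :
    GoodAt y (segment ℝ p q) := by
  by_cases hh : p.2 = q.2 ∧ p.2 = y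
  · obtain ⟨h1, rfl⟩ := hh
    refine ⟨min p.1 q.1, max p.1 q.1, ?_, ?_⟩ <;> rw [seg_horiz h1]
    · intro x hx
      exact ⟨rfl, hx⟩
    · refine Set.finite_empty.subset ?_
      rintro z ⟨⟨-, h1⟩, -, h2⟩
      exact h2 h1
  · have ht : ThinAt y (segment ℝ p q) := by
      rcases h with h | h
      · exact thin_vert y h
      · exact thin_off h fun h' => hh ⟨h, h'⟩
    refine ⟨1, 0, fun x hx => ?_, ht.subset ?_⟩
    · exact absurd (hx.1.trans hx.2) (by norm_num)
    · rintro z ⟨h1, h2, -⟩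
      exact ⟨h1, h2⟩

theorem good_path (y : ℝ) {P : Set (ℝ × ℝ)} (hP : IsAA2BendPath P) : GoodAt y P := by
  rcases hP with ⟨p, q, -, h, rfl⟩ | ⟨p, q, r, -, -, h, rfl⟩ |
    ⟨p, q, r, s, hpq, hqr, hrs, h1, h2, rfl⟩
  · exact good_seg y h
  · rcases h with ⟨h1, h2⟩ | ⟨h1, h2⟩
    · exact thin_good (thin_vert y h1) (good_seg y (Or.inr h2))
    · exact good_thin (good_seg y (Or.inr h1)) (thin_vert y h2)
  · rcases h1 with ⟨h1, h1'⟩ | ⟨h1, h1'⟩ <;> rcases h2 with ⟨h2, h2'⟩ | ⟨h2, h2'⟩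
    · exact absurd (Prod.ext h2 h1') hqr
    · exact good_thin (thin_good (thin_vert y h1) (good_seg y (Or.inr h2))) (thin_vert y h2')
    · by_cases hy : p.2 = y
      · refine good_thin (good_thin (good_seg y (Or.inr h1)) (thin_vert y h1')) (thin_off h2' ?_)
        intro h
        exact hqr (Prod.ext h1' (by rw [← h1, hy, h]))
      · rw [union_assoc]
        exact thin_good (thin_off h1 hy) (thin_good (thin_vert y h1') (good_seg y (Or.inr h2')))
    · exact absurd (Prod.ext h1' h2) hqr

theorem horiz_Icc {s : Set (ℝ × ℝ)} {y : ℝ} (hs : IsHorizSegOn s y) :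
    ∃ a b : ℝ, a < b ∧ s = {z | z.2 = y ∧ z.1 ∈ Icc a b} := by
  obtain ⟨p, q, hne, rfl, h, rfl⟩ := hs
  refine ⟨_, _, ?_, seg_horiz h.symm⟩
  rw [min_lt_max]
  intro h'
  exact hne (Prod.ext h' h.symm)

theorem infinite_of_Icc {S : Set (ℝ × ℝ)} {y a b : ℝ} (hab : a < b)
    (h : ∀ x ∈ Icc a b, (x, y) ∈ S) : S.Infinite := by
  refine ((Set.Icc_infinite hab).image (f := fun x => (x, y)) ?_).mono ?_
  · intro u _ v _ h
    exact (Prod.ext_iff.1 h).1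
  · rintro _ ⟨x, hx, rfl⟩
    exact h x hx

theorem overlap {S : Set (ℝ × ℝ)} {y a b c d : ℝ}
    (hf : (S ∩ {z | z.2 = y ∧ z.1 ∉ Icc a b}).Finite)
    (hi : (S ∩ {z | z.2 = y ∧ z.1 ∈ Icc c d}).Infinite) : max a c < min b d := by
  by_contra hn
  rw [not_lt] at hn
  refine hi ((hf.union (Set.finite_singleton (max a c, y))).subset ?_)
  rintro z ⟨hz, hy, hc, hd⟩
  by_cases h : z.1 ∈ Icc a b
  · right
    refine Prod.ext (le_antisymm ?_ ?_) hy
    · exact (le_min h.2 hd).trans hn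
    · exact max_le h.1 hc
  · exact Or.inl ⟨hz, hy, h⟩

/-- Two collinear horizontal segments (with finite mutual intersection) cannot both be
adjacent to two mutually non-adjacent 2-bend paths: if `P` and `Q` each have infinite
intersection with both segments, then `P ∩ Q` is infinite. -/
theorem stmt5 (s t P Q : Set (ℝ × ℝ)) (y : ℝ)
    (hs : IsHorizSegOn s y) (ht : IsHorizSegOn t y) (hst : (s ∩ t).Finite)
    (hP : IsAA2BendPath P) (hQ : IsAA2BendPath Q)
    (hPs : (P ∩ s).Infinite) (hPt : (P ∩ t).Infinite)
    (hQs : (Q ∩ s).Infinite) (hQt : (Q ∩ t).Infinite) :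
    (P ∩ Q).Infinite := by
  obtain ⟨a, b, hA, hA'⟩ := good_path y hP
  obtain ⟨c, d, hC, hC'⟩ := good_path y hQ
  obtain ⟨s1, s2, hs12, rfl⟩ := horiz_Icc hs
  obtain ⟨t1, t2, ht12, rfl⟩ := horiz_Icc ht
  have e1 := overlap hA' hPs
  have e2 := overlap hA' hPt
  have e3 := overlap hC' hQs
  have e4 := overlap hC' hQt
  have e5 : min s2 t2 ≤ max s1 t1 := by
    by_contra hn
    rw [not_le] at hn
    refine infinite_of_Icc (y := y) hn ?_ hst
    intro x hx
    simp only [mem_Icc, max_le_iff, le_min_iff] at hx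
    exact ⟨⟨rfl, hx.1.1, hx.2.1⟩, ⟨rfl, hx.1.2, hx.2.2⟩⟩
  have e6 : max a c < min b d := by
    simp only [max_lt_iff, lt_min_iff, min_le_iff, le_max_iff] at *
    grind
  refine infinite_of_Icc (y := y) e6 ?_
  intro x hx
  simp only [mem_Icc, max_le_iff, le_min_iff] at hx
  exact ⟨hA x ⟨hx.1.1, hx.2.1⟩, hC x ⟨hx.1.2, hx.2.2⟩⟩
end

section
/- There exist two closed horizontal segments s and t of positive length lying on two distinct horizontal lines, and two axis-aligned 2-bend paths P and Q with P ∩ Q finite, such that each of P and Q has infinite intersection with each of s and t. Moreover, the same holds when s is horizontal and t is vertical with s ∩ t nonempty. That is, two non-collinear parallel segments, as well as two mutually intersecting perpendicular segments, can both be adjacent to two mutually non-adjacent 2-bend paths. -/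
open Set

theorem seg_infinite {a b : ℝ × ℝ} (h : a ≠ b) : (segment ℝ a b).Infinite :=
  (convex_segment a b).isPreconnected.infinite_of_nontrivial
    ⟨a, left_mem_segment ℝ a b, b, right_mem_segment ℝ a b, h⟩

theorem inter_infinite {P p q a b} (h : a ≠ b) (hP : segment ℝ a b ⊆ P)
    (ha : a ∈ segment ℝ p q) (hb : b ∈ segment ℝ p q) :
    (P ∩ segment ℝ p q : Set (ℝ × ℝ)).Infinite :=
  (seg_infinite h).mono (subset_inter hP ((convex_segment p q).segment_subset ha hb))

theorem mem_seg {p q a : ℝ × ℝ} (u : ℝ) (h0 : 0 ≤ u) (h1 : u ≤ 1)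
    (hx : (1 - u) * p.1 + u * q.1 = a.1) (hy : (1 - u) * p.2 + u * q.2 = a.2) :
    a ∈ segment ℝ p q :=
  ⟨1 - u, u, by linarith, h0, by ring, Prod.ext (by simpa using hx) (by simpa using hy)⟩

/-- Two non-collinear parallel segments, as well as two mutually intersecting
perpendicular segments, can both be adjacent to two mutually non-adjacent 2-bend paths. -/
theorem stmt6 :
    (∃ (s t P Q : Set (ℝ × ℝ)) (y1 y2 : ℝ), y1 ≠ y2 ∧
      IsHorizSegOn s y1 ∧ IsHorizSegOn t y2 ∧
      IsAA2BendPath P ∧ IsAA2BendPath Q ∧ (P ∩ Q).Finite ∧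
      (P ∩ s).Infinite ∧ (P ∩ t).Infinite ∧ (Q ∩ s).Infinite ∧ (Q ∩ t).Infinite) ∧
    (∃ (s t P Q : Set (ℝ × ℝ)) (y : ℝ),
      IsHorizSegOn s y ∧ IsVertSeg t ∧ (s ∩ t).Nonempty ∧
      IsAA2BendPath P ∧ IsAA2BendPath Q ∧ (P ∩ Q).Finite ∧
      (P ∩ s).Infinite ∧ (P ∩ t).Infinite ∧ (Q ∩ s).Infinite ∧ (Q ∩ t).Infinite) := by
  constructor
  · refine ⟨segment ℝ (0, 0) (3, 0), segment ℝ (0, 1) (3, 1),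
      segment ℝ (0, 0) (1, 0) ∪ segment ℝ (1, 0) (1, 1) ∪ segment ℝ (1, 1) (0, 1),
      segment ℝ (3, 0) (2, 0) ∪ segment ℝ (2, 0) (2, 1) ∪ segment ℝ (2, 1) (3, 1),
      0, 1, by norm_num, ⟨(0, 0), (3, 0), by norm_num, rfl, rfl, rfl⟩,
      ⟨(0, 1), (3, 1), by norm_num, rfl, rfl, rfl⟩,
      Or.inr (Or.inr ⟨(0, 0), (1, 0), (1, 1), (0, 1), ?_, ?_, ?_, Or.inr ⟨rfl, rfl⟩, Or.inl ⟨rfl, rfl⟩, rfl⟩),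
      Or.inr (Or.inr ⟨(3, 0), (2, 0), (2, 1), (3, 1), ?_, ?_, ?_, Or.inr ⟨rfl, rfl⟩, Or.inl ⟨rfl, rfl⟩, rfl⟩),
      ?_, ?_, ?_, ?_, ?_⟩
    any_goals (norm_num; done)
    · have hP : segment ℝ (0, 0) (1, 0) ∪ segment ℝ (1, 0) (1, 1) ∪ segment ℝ (1, 1) (0, 1)
          ⊆ Icc ((0 : ℝ), (0 : ℝ)) (1, 1) := by
        refine union_subset (union_subset ?_ ?_) ?_ <;>
          exact (convex_Icc _ _).segment_subset (by simp [Prod.le_def]) (by simp [Prod.le_def])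
      have hQ : segment ℝ (3, 0) (2, 0) ∪ segment ℝ (2, 0) (2, 1) ∪ segment ℝ (2, 1) (3, 1)
          ⊆ Icc ((2 : ℝ), (0 : ℝ)) (3, 1) := by
        refine union_subset (union_subset ?_ ?_) ?_ <;>
          exact (convex_Icc _ _).segment_subset
            (by norm_num [Prod.le_def]) (by norm_num [Prod.le_def])
      refine Set.finite_empty.subset ?_
      rintro x ⟨h1, h2⟩
      have h1 := (hP h1).2.1
      have h2 := (hQ h2).1.1
      simp only at h1 h2
      linarith
    · exact inter_infinite (a := (0, 0)) (b := (1, 0)) (by simp) (fun x hx => Or.inl (Or.inl hx))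
        (left_mem_segment _ _ _) (mem_seg (1/3) (by norm_num) (by norm_num) (by norm_num) (by norm_num))
    · exact inter_infinite (a := (1, 1)) (b := (0, 1)) (by simp) (fun x hx => Or.inr hx)
        (mem_seg (1/3) (by norm_num) (by norm_num) (by norm_num) (by norm_num)) (left_mem_segment _ _ _)
    · exact inter_infinite (a := (3, 0)) (b := (2, 0)) (by norm_num) (fun x hx => Or.inl (Or.inl hx))
        (right_mem_segment _ _ _) (mem_seg (2/3) (by norm_num) (by norm_num) (by norm_num) (by norm_num))
    · exact inter_infinite (a := (2, 1)) (b := (3, 1)) (by norm_num) (fun x hx => Or.inr hx)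
        (mem_seg (2/3) (by norm_num) (by norm_num) (by norm_num) (by norm_num)) (right_mem_segment _ _ _)
  · have hs : ((0 : ℝ), (0 : ℝ)) ∈ segment ℝ ((-1 : ℝ), (0 : ℝ)) (1, 0) :=
      mem_seg (1/2) (by norm_num) (by norm_num) (by norm_num) (by norm_num)
    have ht : ((0 : ℝ), (0 : ℝ)) ∈ segment ℝ ((0 : ℝ), (-1 : ℝ)) (0, 1) :=
      mem_seg (1/2) (by norm_num) (by norm_num) (by norm_num) (by norm_num)
    refine ⟨segment ℝ (-1, 0) (1, 0), segment ℝ (0, -1) (0, 1),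
      segment ℝ (1, 0) (0, 0) ∪ segment ℝ (0, 0) (0, 1),
      segment ℝ (-1, 0) (0, 0) ∪ segment ℝ (0, 0) (0, -1),
      0, ⟨(-1, 0), (1, 0), by norm_num, rfl, rfl, rfl⟩,
      ⟨(0, -1), (0, 1), by norm_num, rfl, rfl⟩, ⟨(0, 0), hs, ht⟩,
      Or.inr (Or.inl ⟨(1, 0), (0, 0), (0, 1), ?_, ?_, Or.inr ⟨rfl, rfl⟩, rfl⟩),
      Or.inr (Or.inl ⟨(-1, 0), (0, 0), (0, -1), ?_, ?_, Or.inr ⟨rfl, rfl⟩, rfl⟩),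
      ?_, ?_, ?_, ?_, ?_⟩
    any_goals (norm_num; done)
    · have hP : segment ℝ (1, 0) (0, 0) ∪ segment ℝ (0, 0) (0, 1)
          ⊆ Ici ((0 : ℝ), (0 : ℝ)) := by
        refine union_subset ?_ ?_ <;>
          exact (convex_Ici _).segment_subset (by simp [Prod.le_def]) (by simp [Prod.le_def])
      have hQ : segment ℝ (-1, 0) (0, 0) ∪ segment ℝ (0, 0) (0, -1)
          ⊆ Iic ((0 : ℝ), (0 : ℝ)) := by
        refine union_subset ?_ ?_ <;>
          exact (convex_Iic _).segment_subset (by simp [Prod.le_def]) (by simp [Prod.le_def])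
      refine (Set.finite_singleton ((0 : ℝ), (0 : ℝ))).subset ?_
      rintro x ⟨h1, h2⟩
      exact le_antisymm (hQ h2) (hP h1)
    · exact inter_infinite (a := (1, 0)) (b := (0, 0)) (by simp) (fun x hx => Or.inl hx)
        (right_mem_segment _ _ _) hs
    · exact inter_infinite (a := (0, 0)) (b := (0, 1)) (by simp) (fun x hx => Or.inr hx)
        ht (right_mem_segment _ _ _)
    · exact inter_infinite (a := (-1, 0)) (b := (0, 0)) (by simp) (fun x hx => Or.inl hx)
        (left_mem_segment _ _ _) hs
    · exact inter_infinite (a := (0, 0)) (b := (0, -1)) (by simp) (fun x hx => Or.inr hx)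
        ht (left_mem_segment _ _ _)
end

section
/- Let P be an axis-aligned 2-bend path consisting of exactly three segments of positive length (consecutive segments perpendicular). If s₁, …, s_k are closed segments of positive length with pairwise finite intersections such that for each i the set sᵢ ∩ P is infinite and sᵢ is not contained in P, then k ≤ 6. Moreover, there exist an axis-aligned 2-bend path P and six such segments, so the bound 6 is attained: six pairwise non-adjacent segments may exit a 2-bend path without having to bend inside it. -/
open Set

/-- A closed segment of positive length. -/
def IsSeg (s : Set (ℝ × ℝ)) : Prop := ∃ p q : ℝ × ℝ, p ≠ q ∧ s = segment ℝ p q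

/-- An axis-aligned path consisting of exactly three segments of positive length,
consecutive segments perpendicular. -/
def IsAA3SegPath (P : Set (ℝ × ℝ)) : Prop :=
  ∃ p q r s : ℝ × ℝ, p ≠ q ∧ q ≠ r ∧ r ≠ s ∧ Perp p q r ∧ Perp q r s ∧
    P = segment ℝ p q ∪ segment ℝ q r ∪ segment ℝ r s

/-- The set `t` contains a germ of the segment from `a` towards `b` at the endpoint `a`. -/
def Germ (t : Set (ℝ × ℝ)) (a b : ℝ × ℝ) : Prop :=
  ∃ ε : ℝ, 0 < ε ∧ ∀ τ : ℝ, 0 ≤ τ → τ ≤ ε → a + τ • (b - a) ∈ t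

lemma germ_aux {t : Set (ℝ × ℝ)} (ht : Convex ℝ t) {a b : ℝ × ℝ} {ζ ξ : ℝ}
    (hζ : ζ < 0) (hξ : 0 < ξ) (hz : a + ζ • (b - a) ∈ t) (hx : a + ξ • (b - a) ∈ t) :
    Germ t a b := by
  refine ⟨ξ, hξ, fun τ h0 h1 => ?_⟩
  have hd : 0 < ξ - ζ := by linarith
  have := ht hz hx (a := (ξ - τ) / (ξ - ζ)) (b := (τ - ζ) / (ξ - ζ))
    (div_nonneg (by linarith) hd.le) (div_nonneg (by linarith) hd.le)
    (by field_simp; ring)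
  convert this using 1
  ext <;> simp <;> field_simp <;> ring

lemma germ_of {t : Set (ℝ × ℝ)} (hs : IsSeg t) {a b : ℝ × ℝ}
    (hinf : (t ∩ segment ℝ a b).Infinite) (hn : ¬ t ⊆ segment ℝ a b) :
    Germ t a b ∨ Germ t b a := by
  obtain ⟨u, v, huv, rfl⟩ := hs
  have hconv := convex_segment (𝕜 := ℝ) u v
  obtain ⟨x, ⟨hxt, hxA⟩, y, ⟨hyt, hyA⟩, hxy⟩ := hinf.nontrivial
  obtain ⟨z, hzt, hzA⟩ := not_subset.1 hn
  have hxt' := hxt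
  have hyt' := hyt
  have hzt' := hzt
  rw [segment_eq_image'] at hxt hyt hzt hxA hyA hzA
  obtain ⟨α, -, rfl⟩ := hxt
  obtain ⟨β, -, rfl⟩ := hyt
  obtain ⟨γ, -, rfl⟩ := hzt
  obtain ⟨ξ, hξ, hx⟩ := hxA
  obtain ⟨η, hη, hy⟩ := hyA
  simp only at hx hy hzA hxt' hyt' hzt' hxy
  have hαβ : β - α ≠ 0 := by
    intro h
    apply hxy
    rw [show β = α by linarith]
  have hξη : ξ ≠ η := by
    rintro rfl
    exact hxy (hx.symm.trans hy)
  obtain ⟨ζ, hz⟩ : ∃ ζ : ℝ, a + ζ • (b - a) = u + γ • (v - u) := by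
    refine ⟨ξ + (γ - α) / (β - α) * (η - ξ), ?_⟩
    have h1 : a + (ξ + (γ - α) / (β - α) * (η - ξ)) • (b - a)
        = (a + ξ • (b - a)) + ((γ - α) / (β - α)) • ((a + η • (b - a)) - (a + ξ • (b - a))) := by
      module
    rw [h1, hx, hy]
    have h2 : ((u + β • (v - u)) - (u + α • (v - u))) = (β - α) • (v - u) := by module
    rw [h2, smul_smul, div_mul_cancel₀ _ hαβ]
    module
  rw [← hx] at hxt'
  rw [← hy] at hyt'
  rw [← hz] at hzt'
  have flip : ∀ c : ℝ, a + c • (b - a) = b + (1 - c) • (a - b) := fun c => by module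
  by_cases h0 : ζ < 0
  · left
    rcases lt_or_gt_of_ne hξη with h | h
    · exact germ_aux hconv h0 (lt_of_le_of_lt hξ.1 h) hzt' hyt'
    · exact germ_aux hconv h0 (lt_of_le_of_lt hη.1 h) hzt' hxt'
  · by_cases h1 : 1 < ζ
    · right
      rw [flip] at hxt' hyt' hzt'
      rcases lt_or_gt_of_ne hξη with h | h
      · exact germ_aux hconv (by linarith) (by linarith [hη.2]) hzt' hxt'
      · exact germ_aux hconv (by linarith) (by linarith [hξ.2]) hzt' hyt'
    · exact absurd ⟨ζ, ⟨not_lt.1 h0, not_lt.1 h1⟩, hz⟩ hzA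

lemma germ_inter {t t' : Set (ℝ × ℝ)} {a b : ℝ × ℝ} (hab : a ≠ b)
    (h : Germ t a b) (h' : Germ t' a b) : (t ∩ t').Infinite := by
  obtain ⟨ε, he, h⟩ := h
  obtain ⟨ε', he', h'⟩ := h'
  have hI : (Icc (0 : ℝ) (min ε ε')).Infinite := Icc_infinite (lt_min he he')
  have hinj : InjOn (fun τ : ℝ => a + τ • (b - a)) (Icc (0 : ℝ) (min ε ε')) := by
    intro x _ y _ hxy
    exact smul_left_injective ℝ (sub_ne_zero.2 hab.symm) (add_left_cancel hxy)
  refine (hI.image hinj).mono ?_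
  rintro _ ⟨τ, hτ, rfl⟩
  exact ⟨h τ hτ.1 (hτ.2.trans (min_le_left _ _)), h' τ hτ.1 (hτ.2.trans (min_le_right _ _))⟩

lemma seg_h {a b c : ℝ} (h : a ≤ b) :
    segment ℝ ((a, c) : ℝ × ℝ) (b, c) = {x | a ≤ x.1 ∧ x.1 ≤ b ∧ x.2 = c} := by
  rw [← Prod.image_mk_segment_left, segment_eq_Icc h]
  ext ⟨x, y⟩
  simp only [mem_image, mem_Icc, Prod.mk.injEq, mem_setOf_eq]
  constructor
  · rintro ⟨z, hz, rfl, rfl⟩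
    exact ⟨hz.1, hz.2, rfl⟩
  · rintro ⟨h1, h2, rfl⟩
    exact ⟨x, ⟨h1, h2⟩, rfl, rfl⟩

lemma seg_v {a b c : ℝ} (h : a ≤ b) :
    segment ℝ ((c, a) : ℝ × ℝ) (c, b) = {x | a ≤ x.2 ∧ x.2 ≤ b ∧ x.1 = c} := by
  rw [← Prod.image_mk_segment_right, segment_eq_Icc h]
  ext ⟨x, y⟩
  simp only [mem_image, mem_Icc, Prod.mk.injEq, mem_setOf_eq]
  constructor
  · rintro ⟨z, hz, rfl, rfl⟩
    exact ⟨hz.1, hz.2, rfl⟩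
  · rintro ⟨h1, h2, rfl⟩
    exact ⟨y, ⟨h1, h2⟩, rfl, rfl⟩

lemma seg_infinite_s8 {p q : ℝ × ℝ} (h : p ≠ q) : (segment ℝ p q).Infinite := by
  have hg : Germ (segment ℝ p q) p q := by
    refine ⟨1, one_pos, fun τ h0 h1 => ?_⟩
    rw [segment_eq_image']
    exact ⟨τ, ⟨h0, h1⟩, rfl⟩
  simpa using germ_inter h hg hg

/-- The six segments exiting the extremal example. -/
def exT : Fin 6 → Set (ℝ × ℝ) :=
  ![segment ℝ (-1, 0) (1, 0), segment ℝ (2, 0) (4, 0), segment ℝ (3, -1) (3, 1),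
    segment ℝ (3, 2) (3, 4), segment ℝ (2, 3) (4, 3), segment ℝ (5, 3) (7, 3)]

/-- The extremal path. -/
def exP : Set (ℝ × ℝ) :=
  segment ℝ (0, 0) (3, 0) ∪ segment ℝ (3, 0) (3, 3) ∪ segment ℝ (3, 3) (6, 3)

lemma exP_eq : exP = {x : ℝ × ℝ | ((0 ≤ x.1 ∧ x.1 ≤ 3 ∧ x.2 = 0) ∨
    (0 ≤ x.2 ∧ x.2 ≤ 3 ∧ x.1 = 3)) ∨ (3 ≤ x.1 ∧ x.1 ≤ 6 ∧ x.2 = 3)} := by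
  unfold exP
  rw [seg_h (by norm_num), seg_v (by norm_num), seg_h (by norm_num)]
  rfl

lemma exT_eq : exT = ![{x | -1 ≤ x.1 ∧ x.1 ≤ 1 ∧ x.2 = 0}, {x | 2 ≤ x.1 ∧ x.1 ≤ 4 ∧ x.2 = 0},
    {x | -1 ≤ x.2 ∧ x.2 ≤ 1 ∧ x.1 = 3}, {x | 2 ≤ x.2 ∧ x.2 ≤ 4 ∧ x.1 = 3},
    {x | 2 ≤ x.1 ∧ x.1 ≤ 4 ∧ x.2 = 3}, {x | 5 ≤ x.1 ∧ x.1 ≤ 7 ∧ x.2 = 3}] := by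
  unfold exT
  rw [seg_h (by norm_num), seg_h (by norm_num), seg_v (by norm_num), seg_v (by norm_num),
    seg_h (by norm_num), seg_h (by norm_num)]

lemma inf_h_s8 {S : Set (ℝ × ℝ)} (a b c : ℝ) (h : a < b)
    (hS : ∀ x : ℝ × ℝ, a ≤ x.1 → x.1 ≤ b → x.2 = c → x ∈ S) : S.Infinite := by
  have := seg_infinite_s8 (p := (a, c)) (q := (b, c)) (by simp [h.ne])
  rw [seg_h h.le] at this
  exact this.mono fun x hx => hS x hx.1 hx.2.1 hx.2.2

lemma inf_v {S : Set (ℝ × ℝ)} (a b c : ℝ) (h : a < b)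
    (hS : ∀ x : ℝ × ℝ, a ≤ x.2 → x.2 ≤ b → x.1 = c → x ∈ S) : S.Infinite := by
  have := seg_infinite_s8 (p := (c, a)) (q := (c, b)) (by simp [h.ne])
  rw [seg_v h.le] at this
  exact this.mono fun x hx => hS x hx.1 hx.2.1 hx.2.2

lemma ex_finite (i j : Fin 6) (hij : i ≠ j) : (exT i ∩ exT j).Finite := by
  apply Set.Subsingleton.finite
  rintro ⟨x, y⟩ ⟨h1, h2⟩ ⟨x', y'⟩ ⟨h3, h4⟩
  rw [exT_eq] at h1 h2 h3 h4
  fin_cases i <;> fin_cases j <;> first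
    | exact absurd rfl hij
    | (simp at h1 h2 h3 h4
       obtain ⟨_, _, _⟩ := h1
       obtain ⟨_, _, _⟩ := h2
       obtain ⟨_, _, _⟩ := h3
       obtain ⟨_, _, _⟩ := h4
       ext <;> simp only <;> linarith)

lemma ex_infinite (i : Fin 6) : (exT i ∩ exP).Infinite := by
  rw [exT_eq, exP_eq]
  fin_cases i
  · exact inf_h_s8 0 1 0 (by norm_num) fun x h1 h2 h3 =>
      ⟨⟨by linarith, by linarith, h3⟩, Or.inl (Or.inl ⟨by linarith, by linarith, h3⟩)⟩
  · exact inf_h_s8 2 3 0 (by norm_num) fun x h1 h2 h3 =>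
      ⟨⟨by linarith, by linarith, h3⟩, Or.inl (Or.inl ⟨by linarith, by linarith, h3⟩)⟩
  · exact inf_v 0 1 3 (by norm_num) fun x h1 h2 h3 =>
      ⟨⟨by linarith, by linarith, h3⟩, Or.inl (Or.inr ⟨by linarith, by linarith, h3⟩)⟩
  · exact inf_v 2 3 3 (by norm_num) fun x h1 h2 h3 =>
      ⟨⟨by linarith, by linarith, h3⟩, Or.inl (Or.inr ⟨by linarith, by linarith, h3⟩)⟩
  · exact inf_h_s8 3 4 3 (by norm_num) fun x h1 h2 h3 =>
      ⟨⟨by linarith, by linarith, h3⟩, Or.inr ⟨by linarith, by linarith, h3⟩⟩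
  · exact inf_h_s8 5 6 3 (by norm_num) fun x h1 h2 h3 =>
      ⟨⟨by linarith, by linarith, h3⟩, Or.inr ⟨by linarith, by linarith, h3⟩⟩

lemma ex_not_subset (i : Fin 6) : ¬ exT i ⊆ exP := by
  rw [exT_eq, exP_eq, not_subset]
  fin_cases i
  · exact ⟨(-1, 0), by norm_num, by norm_num⟩
  · exact ⟨(4, 0), by norm_num, by norm_num⟩
  · exact ⟨(3, -1), by norm_num, by norm_num⟩
  · exact ⟨(3, 4), by norm_num, by norm_num⟩
  · exact ⟨(2, 3), by norm_num, by norm_num⟩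
  · exact ⟨(7, 3), by norm_num, by norm_num⟩

lemma ex_seg (i : Fin 6) : IsSeg (exT i) := by
  fin_cases i
  · exact ⟨(-1, 0), (1, 0), by norm_num, rfl⟩
  · exact ⟨(2, 0), (4, 0), by norm_num, rfl⟩
  · exact ⟨(3, -1), (3, 1), by norm_num, rfl⟩
  · exact ⟨(3, 2), (3, 4), by norm_num, rfl⟩
  · exact ⟨(2, 3), (4, 3), by norm_num, rfl⟩
  · exact ⟨(5, 3), (7, 3), by norm_num, rfl⟩

/-- At most six pairwise non-adjacent segments may exit a 2-bend path (consisting of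
exactly three segments), and the bound six is attained. -/
theorem stmt8 :
    (∀ P : Set (ℝ × ℝ), IsAA3SegPath P →
      ∀ (k : ℕ) (t : Fin k → Set (ℝ × ℝ)),
        (∀ i, IsSeg (t i)) →
        (∀ i j, i ≠ j → (t i ∩ t j).Finite) →
        (∀ i, (t i ∩ P).Infinite) →
        (∀ i, ¬ t i ⊆ P) →
        k ≤ 6) ∧
    (∃ P : Set (ℝ × ℝ), IsAA3SegPath P ∧
      ∃ t : Fin 6 → Set (ℝ × ℝ),
        (∀ i, IsSeg (t i)) ∧
        (∀ i j, i ≠ j → (t i ∩ t j).Finite) ∧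
        (∀ i, (t i ∩ P).Infinite) ∧
        (∀ i, ¬ t i ⊆ P)) := by
  refine ⟨?_, exP, ?_, exT, ex_seg, ex_finite, ex_infinite, ex_not_subset⟩
  · rintro P ⟨p, q, r, s, hpq, hqr, hrs, -, -, rfl⟩ k t hseg hfin hinf hnot
    let A : Fin 6 → ℝ × ℝ := ![p, q, q, r, r, s]
    let B : Fin 6 → ℝ × ℝ := ![q, p, r, q, s, r]
    have hAB : ∀ c, A c ≠ B c := by
      intro c
      fin_cases c
      exacts [hpq, hpq.symm, hqr, hqr.symm, hrs, hrs.symm]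
    have key : ∀ i, ∃ c, Germ (t i) (A c) (B c) := by
      intro i
      have h := hinf i
      have hn := hnot i
      rw [inter_union_distrib_left, inter_union_distrib_left, infinite_union,
        infinite_union] at h
      rcases h with (h | h) | h
      · rcases germ_of (hseg i) h
          (fun h' => hn (h'.trans (subset_union_left.trans subset_union_left))) with g | g
        exacts [⟨0, g⟩, ⟨1, g⟩]
      · rcases germ_of (hseg i) h
          (fun h' => hn (h'.trans (subset_union_right.trans subset_union_left))) with g | g
        exacts [⟨2, g⟩, ⟨3, g⟩]
      · rcases germ_of (hseg i) h (fun h' => hn (h'.trans subset_union_right)) with g | g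
        exacts [⟨4, g⟩, ⟨5, g⟩]
    choose f hf using key
    have hinj : Function.Injective f := by
      intro i j hij
      by_contra hne
      have hj := hf j
      rw [← hij] at hj
      exact germ_inter (hAB _) (hf i) hj (hfin i j hne)
    simpa using Fintype.card_le_of_injective f hinj
  · exact ⟨(0, 0), (3, 0), (3, 3), (6, 3), by norm_num, by norm_num, by norm_num,
      Or.inr ⟨rfl, rfl⟩, Or.inl ⟨rfl, rfl⟩, rfl⟩
end

section
/- For every integer n ≥ 3, the wheel graph W_n admits an unaligned 1-bend EPG representation, i.e., there is an assignment of an unaligned 1-bend path P_v ⊆ ℝ² to each vertex v of W_n such that two distinct vertices u, v are adjacent in W_n if and only if P_u ∩ P_v is infinite. -/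
open Set

/-- An unaligned 1-bend path: a union of at most two closed segments of positive length
sharing an endpoint and not collinear (arbitrary slopes allowed). -/
def IsUn1BendPath (P : Set (ℝ × ℝ)) : Prop :=
  (∃ p q : ℝ × ℝ, p ≠ q ∧ P = segment ℝ p q) ∨
  (∃ p q r : ℝ × ℝ, p ≠ q ∧ q ≠ r ∧ ¬ Collinear ℝ ({p, q, r} : Set (ℝ × ℝ)) ∧
    P = segment ℝ p q ∪ segment ℝ q r)

/-- An unaligned 1-bend EPG representation of a graph. -/
def IsUn1BendEPG {V : Type*} (G : SimpleGraph V) (f : V → Set (ℝ × ℝ)) : Prop :=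
  (∀ v, IsUn1BendPath (f v)) ∧
  ∀ u v : V, u ≠ v → (G.Adj u v ↔ (f u ∩ f v).Infinite)

/-- The wheel graph on `n + 1` vertices: a cycle on `Fin n` together with a hub
vertex `none` adjacent to all cycle vertices. -/
def wheel (n : ℕ) : SimpleGraph (Option (Fin n)) :=
  SimpleGraph.fromRel (fun a b =>
    match a, b with
    | none, some _ => True
    | some i, some j => (j : ℕ) = ((i : ℕ) + 1) % n
    | _, _ => False)

/-- Union of (optionally) the unit segment on the x-axis, (optionally) the hypotenuse
from `(1,0)` to `(0,T)`, and the segment `{0} × [a,b]`. -/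
def shape (T : ℝ) (X H : Prop) (a b : ℝ) : Set (ℝ × ℝ) :=
  {p | (X ∧ 0 ≤ p.1 ∧ p.1 ≤ 1 ∧ p.2 = 0) ∨ (H ∧ 0 ≤ p.1 ∧ p.1 ≤ 1 ∧ p.2 = T * (1 - p.1)) ∨
    (p.1 = 0 ∧ a ≤ p.2 ∧ p.2 ≤ b)}

lemma shape_inter_finite (T : ℝ) (hT : 0 < T) (X H X' H' : Prop) (a b a' b' : ℝ)
    (hX : ¬ (X ∧ X')) (hH : ¬ (H ∧ H')) (hab : min b b' ≤ max a a') :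
    (shape T X H a b ∩ shape T X' H' a' b').Finite := by
  have key : ∀ x : ℝ, 0 = T * (1 - x) → x = 1 := by
    intro x hx
    rcases mul_eq_zero.1 hx.symm with h | h <;> linarith
  apply Set.Finite.subset (s := {((1:ℝ),(0:ℝ)), (0,0), (0,T), (0, max a a')}) (by simp)
  rintro ⟨x, y⟩ ⟨h1, h2⟩
  simp only [shape, Set.mem_ofPred_eq] at h1 h2
  simp only [Set.mem_insert_iff, Set.mem_singleton_iff, Prod.mk.injEq]
  rcases h1 with ⟨hx, h1, h1', h1''⟩ | ⟨hx, h1, h1', h1''⟩ | ⟨h1, h1', h1''⟩ <;>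
  rcases h2 with ⟨hy, h2, h2', h2''⟩ | ⟨hy, h2, h2', h2''⟩ | ⟨h2, h2', h2''⟩
  · exact absurd ⟨hx, hy⟩ hX
  · exact Or.inl ⟨key x (by rw [← h2'', h1'']), h1''⟩
  · exact Or.inr (Or.inl ⟨h2, h1''⟩)
  · exact Or.inl ⟨key x (by rw [← h1'', h2'']), h2''⟩
  · exact absurd ⟨hx, hy⟩ hH
  · exact Or.inr (Or.inr (Or.inl ⟨h2, by rw [h1'', h2]; ring⟩))
  · exact Or.inr (Or.inl ⟨h1, h2''⟩)
  · exact Or.inr (Or.inr (Or.inl ⟨h1, by rw [h2'', h1]; ring⟩))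
  · exact Or.inr (Or.inr (Or.inr ⟨h1, le_antisymm ((le_min h1'' h2'').trans hab)
      (max_le h1' h2')⟩))

lemma shape_inter_infinite (T : ℝ) (X H X' H' : Prop) (a b a' b' : ℝ)
    (h : (X ∧ X') ∨ (H ∧ H') ∨ max a a' < min b b') :
    (shape T X H a b ∩ shape T X' H' a' b').Infinite := by
  rcases h with ⟨h, h'⟩ | ⟨h, h'⟩ | h
  · have := (Set.Icc_infinite (zero_lt_one' ℝ)).image (f := fun x => (x, (0:ℝ)))
      (fun x _ y _ hxy => (Prod.mk.inj hxy).1)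
    refine this.mono ?_
    rintro _ ⟨x, hx, rfl⟩
    exact ⟨Or.inl ⟨h, hx.1, hx.2, rfl⟩, Or.inl ⟨h', hx.1, hx.2, rfl⟩⟩
  · have := (Set.Icc_infinite (zero_lt_one' ℝ)).image (f := fun x => (x, T * (1 - x)))
      (fun x _ y _ hxy => (Prod.mk.inj hxy).1)
    refine this.mono ?_
    rintro _ ⟨x, hx, rfl⟩
    exact ⟨Or.inr (Or.inl ⟨h, hx.1, hx.2, rfl⟩), Or.inr (Or.inl ⟨h', hx.1, hx.2, rfl⟩)⟩
  · have := (Set.Icc_infinite h).image (f := fun x => ((0:ℝ), x))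
      (fun x _ y _ hxy => (Prod.mk.inj hxy).2)
    refine this.mono ?_
    rintro _ ⟨x, ⟨hx, hx'⟩, rfl⟩
    have h1 := max_le_iff.1 hx
    have h2 := le_min_iff.1 hx'
    exact ⟨Or.inr (Or.inr ⟨rfl, h1.1, h2.1⟩), Or.inr (Or.inr ⟨rfl, h1.2, h2.2⟩)⟩

lemma shape_inter_iff (T : ℝ) (hT : 0 < T) (X H X' H' : Prop) (a b a' b' : ℝ) :
    (shape T X H a b ∩ shape T X' H' a' b').Infinite ↔
      ((X ∧ X') ∨ (H ∧ H') ∨ max a a' < min b b') := by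
  refine ⟨fun h => ?_, shape_inter_infinite T X H X' H' a b a' b'⟩
  by_contra hc
  rw [not_or, not_or, not_lt] at hc
  exact h (shape_inter_finite T hT X H X' H' a b a' b' hc.1 hc.2.1 hc.2.2)

lemma mem_seg_x (p : ℝ × ℝ) :
    p ∈ segment ℝ ((0:ℝ),(0:ℝ)) (1,0) ↔ 0 ≤ p.1 ∧ p.1 ≤ 1 ∧ p.2 = 0 := by
  rw [segment_eq_image]
  constructor
  · rintro ⟨t, ⟨h0, h1⟩, rfl⟩
    simp [h0, h1]
  · rintro ⟨h0, h1, h2⟩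
    exact ⟨p.1, ⟨h0, h1⟩, by ext <;> simp [h2]⟩

lemma mem_seg_h (T : ℝ) (p : ℝ × ℝ) :
    p ∈ segment ℝ ((0:ℝ),T) (1,0) ↔ 0 ≤ p.1 ∧ p.1 ≤ 1 ∧ p.2 = T * (1 - p.1) := by
  rw [segment_eq_image]
  constructor
  · rintro ⟨t, ⟨h0, h1⟩, rfl⟩
    simp [h0, h1, mul_comm]
  · rintro ⟨h0, h1, h2⟩
    exact ⟨p.1, ⟨h0, h1⟩, by ext <;> simp [h2, mul_comm]⟩

lemma mem_seg_y (a b : ℝ) (hab : a ≤ b) (p : ℝ × ℝ) :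
    p ∈ segment ℝ ((0:ℝ),a) (0,b) ↔ p.1 = 0 ∧ a ≤ p.2 ∧ p.2 ≤ b := by
  rw [← Prod.image_mk_segment_right, segment_eq_Icc hab]
  constructor
  · rintro ⟨t, ⟨h0, h1⟩, rfl⟩
    exact ⟨rfl, h0, h1⟩
  · rintro ⟨h0, h1, h2⟩
    exact ⟨p.2, ⟨h1, h2⟩, by ext <;> simp [h0]⟩

lemma not_collinear_of_cross (p q r : ℝ × ℝ)
    (h : (p.1 - q.1) * (r.2 - q.2) ≠ (p.2 - q.2) * (r.1 - q.1)) :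
    ¬ Collinear ℝ ({p, q, r} : Set (ℝ × ℝ)) := by
  intro hc
  rw [collinear_iff_of_mem (p₀ := q) (by simp)] at hc
  obtain ⟨v, hv⟩ := hc
  obtain ⟨s, rfl⟩ := hv p (by simp)
  obtain ⟨t, rfl⟩ := hv r (by simp)
  apply h
  simp
  ring

lemma bend_of_cross (p q r : ℝ × ℝ) (P : Set (ℝ × ℝ))
    (h : (p.1 - q.1) * (r.2 - q.2) ≠ (p.2 - q.2) * (r.1 - q.1))
    (hP : P = segment ℝ p q ∪ segment ℝ q r) : IsUn1BendPath P := by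
  refine Or.inr ⟨p, q, r, ?_, ?_, not_collinear_of_cross p q r h, hP⟩
  · rintro rfl; simp at h
  · rintro rfl; simp at h

/-- hub or vertex `1` -/
lemma path_XY (T b : ℝ) (hb : 0 < b) : IsUn1BendPath (shape T True False 0 b) := by
  refine bend_of_cross (1,0) (0,0) (0,b) _ (by simpa using hb.ne') ?_
  ext p
  rw [segment_symm, Set.mem_union, mem_seg_x, mem_seg_y 0 b hb.le]
  simp [shape]

/-- vertex `0` -/
lemma path_XH (T : ℝ) (hT : 0 < T) : IsUn1BendPath (shape T True True 0 0) := by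
  refine bend_of_cross (0,0) (1,0) (0,T) _ (by simpa using hT.ne') ?_
  ext p
  rw [segment_symm ℝ (1,0) (0,T), Set.mem_union, mem_seg_x, mem_seg_h]
  simp only [shape, Set.mem_ofPred_eq, true_and]
  constructor
  · rintro (h | h | ⟨h, h', h''⟩)
    · exact Or.inl h
    · exact Or.inr h
    · exact Or.inl ⟨h.ge, by linarith, le_antisymm h'' h'⟩
  · rintro (h | h)
    · exact Or.inl h
    · exact Or.inr (Or.inl h)

/-- last vertex -/
lemma path_HY (T a : ℝ) (ha : a < T) : IsUn1BendPath (shape T False True a T) := by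
  refine bend_of_cross (0,a) (0,T) (1,0) _ (by simpa using (sub_neg.2 ha).ne.symm) ?_
  ext p
  rw [Set.mem_union, mem_seg_y a T ha.le, mem_seg_h]
  simp only [shape, Set.mem_ofPred_eq, true_and, false_and, false_or]
  exact or_comm

lemma path_Y (T a b : ℝ) (hab : a < b) : IsUn1BendPath (shape T False False a b) := by
  refine Or.inl ⟨(0,a), (0,b), by simpa using hab.ne, ?_⟩
  ext p
  rw [mem_seg_y a b hab.le]
  simp [shape]

/-- The representation of the wheel. -/
def rep (n : ℕ) : Option (Fin n) → Set (ℝ × ℝ)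
  | none => shape ((2 * n - 1 : ℕ) : ℝ) True False ((0 : ℕ) : ℝ) ((2 * n - 1 : ℕ) : ℝ)
  | some i => shape ((2 * n - 1 : ℕ) : ℝ) ((i : ℕ) ≤ 1) ((i : ℕ) = 0 ∨ (i : ℕ) + 1 = n)
      ((2 * i - 2 : ℕ) : ℝ) ((if (i : ℕ) = 0 then 0 else 2 * i + 1 : ℕ) : ℝ)

lemma rep_path (n : ℕ) (hn : 3 ≤ n) (v : Option (Fin n)) : IsUn1BendPath (rep n v) := by
  have hT : (0 : ℝ) < ((2 * n - 1 : ℕ) : ℝ) := by exact_mod_cast (by omega : 0 < 2 * n - 1)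
  rcases v with _ | ⟨i, hi⟩
  · simpa [rep] using path_XY _ _ hT
  · simp only [rep]
    by_cases h0 : i = 0
    · subst h0
      simpa using path_XH _ hT
    by_cases h1 : i = 1
    · subst h1
      have : ¬ (1 + 1 = n) := by omega
      have h := path_XY ((2 * n - 1 : ℕ) : ℝ) 3 (by norm_num)
      simp only [le_refl, one_ne_zero, this, or_self, if_false]
      norm_num
      exact h
    have h2 : ¬ i ≤ 1 := by omega
    have hlt : ((2 * i - 2 : ℕ) : ℝ) < ((2 * i + 1 : ℕ) : ℝ) := by
      exact_mod_cast (by omega : 2 * i - 2 < 2 * i + 1)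
    by_cases h3 : i + 1 = n
    · have h4 : 2 * n - 1 = 2 * i + 1 := by omega
      simp only [h0, h2, h3, if_false, or_true, h4]
      exact path_HY _ _ hlt
    · simp only [h0, h2, h3, if_false, or_false]
      exact path_Y _ _ _ hlt

lemma rep_adj (n : ℕ) (hn : 3 ≤ n) (u v : Option (Fin n)) (huv : u ≠ v) :
    (wheel n).Adj u v ↔ (rep n u ∩ rep n v).Infinite := by
  have hT : (0 : ℝ) < ((2 * n - 1 : ℕ) : ℝ) := by exact_mod_cast (by omega : 0 < 2 * n - 1)
  rcases u with _ | ⟨i, hi⟩ <;> rcases v with _ | ⟨j, hj⟩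
  · exact absurd rfl huv
  · simp only [rep, shape_inter_iff _ hT, ← Nat.cast_max, ← Nat.cast_min, Nat.cast_lt]
    simp only [wheel, SimpleGraph.fromRel_adj]
    refine iff_of_true ⟨huv, Or.inl trivial⟩ ?_
    simp only [true_and, false_and, false_or]
    split_ifs <;> omega
  · simp only [rep, shape_inter_iff _ hT, ← Nat.cast_max, ← Nat.cast_min, Nat.cast_lt]
    simp only [wheel, SimpleGraph.fromRel_adj]
    refine iff_of_true ⟨huv, Or.inr trivial⟩ ?_
    simp only [and_true, and_false, false_or]
    split_ifs <;> omega
  · simp only [rep, shape_inter_iff _ hT, ← Nat.cast_max, ← Nat.cast_min, Nat.cast_lt]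
    simp only [wheel, SimpleGraph.fromRel_adj]
    have hij : i ≠ j := by rintro rfl; exact huv rfl
    have e : ∀ k, k < n → (k + 1) % n = if k + 1 = n then 0 else k + 1 := by
      intro k hk
      split_ifs with h
      · rw [h, Nat.mod_self]
      · exact Nat.mod_eq_of_lt (by omega)
    rw [e i hi, e j hj, and_iff_right huv]
    split_ifs <;> omega

/-- For every `n ≥ 3` the wheel graph `W_n` admits an unaligned 1-bend EPG
representation. -/
theorem stmt10 (n : ℕ) (hn : 3 ≤ n) :
    ∃ f : Option (Fin n) → Set (ℝ × ℝ), IsUn1BendEPG (wheel n) f := by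
  exact ⟨rep n, rep_path n hn, rep_adj n hn⟩
end

section
/- For every positive integer s, the complete bipartite graph K_{2,s} admits an axis-aligned 1-bend EPG representation if and only if s ≤ 4. -/
open Set

/-- An axis-aligned 1-bend path: a union of at most two closed axis-parallel segments of
positive length sharing an endpoint and perpendicular to each other. -/
def IsAA1BendPath (P : Set (ℝ × ℝ)) : Prop :=
  (∃ p q : ℝ × ℝ, p ≠ q ∧ AxisParallel p q ∧ P = segment ℝ p q) ∨
  (∃ p q r : ℝ × ℝ, p ≠ q ∧ q ≠ r ∧ Perp p q r ∧
    P = segment ℝ p q ∪ segment ℝ q r)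

/-- An axis-aligned 1-bend EPG representation of a graph. -/
def IsAA1BendEPG {V : Type*} (G : SimpleGraph V) (f : V → Set (ℝ × ℝ)) : Prop :=
  (∀ v, IsAA1BendPath (f v)) ∧
  ∀ u v : V, u ≠ v → (G.Adj u v ↔ (f u ∩ f v).Infinite)

/-- A path with a given corner and two (possibly degenerate) arms. -/
def LPath (x y x' y' : ℝ) : Set (ℝ × ℝ) :=
  segment ℝ (x, y) (x', y) ∪ segment ℝ (x, y) (x, y')

def Ov (a b c d : ℝ) : Prop := max (min a b) (min c d) < min (max a b) (max c d)

lemma mem_LPath (x y x' y' a b : ℝ) :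
    (a, b) ∈ LPath x y x' y' ↔
      (b = y ∧ min x x' ≤ a ∧ a ≤ max x x') ∨ (a = x ∧ min y y' ≤ b ∧ b ≤ max y y') := by
  unfold LPath
  rw [← Prod.image_mk_segment_left, ← Prod.image_mk_segment_right, segment_eq_uIcc,
    segment_eq_uIcc]
  simp only [Set.mem_union, Set.mem_image, Set.uIcc, Set.mem_Icc, Prod.mk.injEq]
  constructor
  · rintro (⟨t, ht, rfl, rfl⟩ | ⟨t, ht, rfl, rfl⟩)
    · exact Or.inl ⟨rfl, ht⟩
    · exact Or.inr ⟨rfl, ht⟩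
  · rintro (⟨rfl, h⟩ | ⟨rfl, h⟩)
    · exact Or.inl ⟨a, h, rfl, rfl⟩
    · exact Or.inr ⟨b, h, rfl, rfl⟩

lemma exists_LPath {P : Set (ℝ × ℝ)} (h : IsAA1BendPath P) :
    ∃ x y x' y', P = LPath x y x' y' := by
  rcases h with ⟨⟨a, b⟩, ⟨c, d⟩, -, h, rfl⟩ | ⟨⟨a, b⟩, ⟨c, d⟩, ⟨e, f⟩, -, -, h, rfl⟩
  · rcases h with h | h <;> simp only at h <;> subst h
    · refine ⟨a, b, a, d, ?_⟩
      unfold LPath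
      rw [segment_same, Set.union_eq_self_of_subset_left]
      simpa using left_mem_segment ℝ (a, b) (a, d)
    · refine ⟨a, b, c, b, ?_⟩
      unfold LPath
      rw [segment_same, Set.union_eq_self_of_subset_right]
      simpa using left_mem_segment ℝ (a, b) (c, b)
  · rcases h with ⟨h, h'⟩ | ⟨h, h'⟩ <;> simp only at h h' <;> subst h <;> subst h'
    · refine ⟨a, d, e, b, ?_⟩
      unfold LPath
      rw [segment_symm ℝ (a, b), Set.union_comm]
    · refine ⟨c, b, a, f, ?_⟩
      unfold LPath
      rw [segment_symm ℝ (a, b)]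

lemma inter_infinite_s13 (x y x' y' u v u' v' : ℝ) :
    (LPath x y x' y' ∩ LPath u v u' v').Infinite ↔
      (y = v ∧ Ov x x' u u') ∨ (x = u ∧ Ov y y' v v') := by
  constructor
  · intro h
    by_contra hc
    rw [not_or] at hc
    obtain ⟨h1, h2⟩ := hc
    apply h
    apply Set.Finite.subset (s := {(u, y), (x, v), (max (min x x') (min u u'), y),
      (x, max (min y y') (min v v'))}) (Set.toFinite _)
    rintro ⟨a, b⟩ ⟨hp, hq⟩
    rw [mem_LPath] at hp hq
    simp only [Set.mem_insert_iff, Set.mem_singleton_iff, Prod.mk.injEq]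
    rcases hp with ⟨rfl, p1, p2⟩ | ⟨rfl, p1, p2⟩ <;> rcases hq with ⟨rfl, q1, q2⟩ | ⟨rfl, q1, q2⟩
    · have h3 : ¬ Ov x x' u u' := fun h => h1 ⟨rfl, h⟩
      unfold Ov at h3
      have := max_le p1 q1
      have := le_min p2 q2
      exact Or.inr (Or.inr (Or.inl ⟨by linarith, rfl⟩))
    · exact Or.inl ⟨rfl, rfl⟩
    · exact Or.inr (Or.inl ⟨rfl, rfl⟩)
    · have h3 : ¬ Ov y y' v v' := fun h => h2 ⟨rfl, h⟩
      unfold Ov at h3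
      have := max_le p1 q1
      have := le_min p2 q2
      exact Or.inr (Or.inr (Or.inr ⟨rfl, by linarith⟩))
  · rintro (⟨rfl, h⟩ | ⟨rfl, h⟩)
    · apply ((Set.Icc_infinite h).image (f := fun a => (a, y))
        (fun a _ b _ hab => (Prod.mk.inj hab).1)).mono
      rintro _ ⟨a, ⟨ha, hb⟩, rfl⟩
      rw [max_le_iff] at ha
      rw [le_min_iff] at hb
      exact ⟨(mem_LPath ..).2 (Or.inl ⟨rfl, ha.1, hb.1⟩), (mem_LPath ..).2 (Or.inl ⟨rfl, ha.2, hb.2⟩)⟩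
    · apply ((Set.Icc_infinite h).image (f := fun a => (x, a))
        (fun a _ b _ hab => (Prod.mk.inj hab).2)).mono
      rintro _ ⟨a, ⟨ha, hb⟩, rfl⟩
      rw [max_le_iff] at ha
      rw [le_min_iff] at hb
      exact ⟨(mem_LPath ..).2 (Or.inr ⟨rfl, ha.1, hb.1⟩), (mem_LPath ..).2 (Or.inr ⟨rfl, ha.2, hb.2⟩)⟩

lemma ov_gap {a a' b b' c c' d d' : ℝ} (h : ¬ Ov a a' b b') (h1 : Ov a a' c c')
    (h2 : Ov b b' c c') (h3 : Ov a a' d d') (h4 : Ov b b' d d') : Ov c c' d d' := by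
  unfold Ov at *
  generalize min a a' = a0 at *
  generalize max a a' = a1 at *
  generalize min b b' = b0 at *
  generalize max b b' = b1 at *
  generalize min c c' = c0 at *
  generalize max c c' = c1 at *
  generalize min d d' = d0 at *
  generalize max d d' = d1 at *
  simp only [max_lt_iff, lt_min_iff] at *
  grind

lemma ov_corner (p q r : ℝ) : Ov p q p r ↔ (p < q ∧ p < r) ∨ (q < p ∧ r < p) := by
  unfold Ov
  simp only [max_lt_iff, lt_min_iff, min_lt_iff, lt_max_iff, lt_self_iff_false]
  grind

lemma ov_ne {a b c d : ℝ} (h : Ov a b c d) : c ≠ d := by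
  rintro rfl
  unfold Ov at h
  simp at h

lemma ov_corner_trans {p q r s : ℝ} (h : Ov p q p r) (h' : Ov p q p s) : Ov p r p s := by
  rw [ov_corner] at *
  grind

lemma upper {s : ℕ} (x y x' y' : Fin 2 ⊕ Fin s → ℝ)
    (hAB : ¬ ((y (.inl 0) = y (.inl 1) ∧ Ov (x (.inl 0)) (x' (.inl 0)) (x (.inl 1)) (x' (.inl 1))) ∨
      (x (.inl 0) = x (.inl 1) ∧ Ov (y (.inl 0)) (y' (.inl 0)) (y (.inl 1)) (y' (.inl 1)))))
    (hC : ∀ k i, ((y (.inl k) = y (.inr i) ∧ Ov (x (.inl k)) (x' (.inl k)) (x (.inr i)) (x' (.inr i))) ∨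
      (x (.inl k) = x (.inr i) ∧ Ov (y (.inl k)) (y' (.inl k)) (y (.inr i)) (y' (.inr i)))))
    (hD : ∀ i j, i ≠ j → ¬ ((y (.inr i) = y (.inr j) ∧
        Ov (x (.inr i)) (x' (.inr i)) (x (.inr j)) (x' (.inr j))) ∨
      (x (.inr i) = x (.inr j) ∧ Ov (y (.inr i)) (y' (.inr i)) (y (.inr j)) (y' (.inr j))))) :
    s ≤ 4 := by
  classical
  suffices h : ∃ g : Fin s → Bool × Bool, Function.Injective g by
    obtain ⟨g, hg⟩ := h
    simpa using Fintype.card_le_of_injective g hg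
  rw [not_or] at hAB
  obtain ⟨hh, hv⟩ := hAB
  let H : Fin 2 → Fin s → Prop := fun k i =>
    y (.inl k) = y (.inr i) ∧ Ov (x (.inl k)) (x' (.inl k)) (x (.inr i)) (x' (.inr i))
  let W : Fin 2 → Fin s → Prop := fun k i =>
    x (.inl k) = x (.inr i) ∧ Ov (y (.inl k)) (y' (.inl k)) (y (.inr i)) (y' (.inr i))
  have hHW : ∀ k i, ¬ H k i → W k i := fun k i h => (hC k i).resolve_left h
  -- at most one of type HH, at most one of type VV
  have hHH : ∀ i j, H 0 i → H 1 i → H 0 j → H 1 j → i = j := by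
    intro i j a b c d
    by_contra hij
    exact hD i j hij (Or.inl ⟨a.1.symm.trans c.1,
      ov_gap (fun h => hh ⟨a.1.trans b.1.symm, h⟩) a.2 b.2 c.2 d.2⟩)
  have hWW : ∀ i j, W 0 i → W 1 i → W 0 j → W 1 j → i = j := by
    intro i j a b c d
    by_contra hij
    exact hD i j hij (Or.inr ⟨a.1.symm.trans c.1,
      ov_gap (fun h => hv ⟨a.1.trans b.1.symm, h⟩) a.2 b.2 c.2 d.2⟩)
  -- overlapping at a corner
  have cornerH : ∀ k i j, x (.inr i) = x (.inl k) → x (.inr j) = x (.inl k) →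
      H k i → H k j → i = j := by
    intro k i j e1 e2 a b
    by_contra hij
    refine hD i j hij (Or.inl ⟨a.1.symm.trans b.1, ?_⟩)
    have a2 := a.2
    have b2 := b.2
    rw [e1] at a2 ⊢
    rw [e2] at b2 ⊢
    exact ov_corner_trans a2 b2
  have cornerW : ∀ k i j, y (.inr i) = y (.inl k) → y (.inr j) = y (.inl k) →
      W k i → W k j → i = j := by
    intro k i j e1 e2 a b
    by_contra hij
    refine hD i j hij (Or.inr ⟨a.1.symm.trans b.1, ?_⟩)
    have a2 := a.2
    have b2 := b.2
    rw [e1] at a2 ⊢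
    rw [e2] at b2 ⊢
    exact ov_corner_trans a2 b2
  by_cases hex : ∃ i, (H 0 i ∧ H 1 i) ∨ (¬ H 0 i ∧ ¬ H 1 i)
  · refine ⟨fun i => (decide (H 0 i), decide (H 1 i)), ?_⟩
    intro i j hij
    simp only [Prod.mk.injEq, decide_eq_decide] at hij
    obtain ⟨e0, e1⟩ := hij
    have hline : y (.inl 0) = y (.inl 1) ∨ x (.inl 0) = x (.inl 1) := by
      obtain ⟨k, ⟨a, b⟩ | ⟨a, b⟩⟩ := hex
      · exact Or.inl (a.1.trans b.1.symm)
      · exact Or.inr ((hHW _ _ a).1.trans (hHW _ _ b).1.symm)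
    by_cases h0 : H 0 i <;> by_cases h1 : H 1 i
    · exact hHH i j h0 h1 (e0.1 h0) (e1.1 h1)
    · have w1 := hHW _ _ h1
      have w1' := hHW _ _ (fun h => h1 (e1.2 h))
      have h0' := e0.1 h0
      rcases hline with e | e
      · exact cornerW 1 i j (h0.1.symm.trans e) (h0'.1.symm.trans e) w1 w1'
      · exact cornerH 0 i j (w1.1.symm.trans e.symm) (w1'.1.symm.trans e.symm) h0 h0'
    · have w0 := hHW _ _ h0
      have w0' := hHW _ _ (fun h => h0 (e0.2 h))
      have h1' := e1.1 h1
      rcases hline with e | e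
      · exact cornerW 0 i j (h1.1.symm.trans e.symm) (h1'.1.symm.trans e.symm) w0 w0'
      · exact cornerH 1 i j (w0.1.symm.trans e) (w0'.1.symm.trans e) h1 h1'
    · exact hWW i j (hHW _ _ h0) (hHW _ _ h1) (hHW _ _ (fun h => h0 (e0.2 h)))
        (hHW _ _ (fun h => h1 (e1.2 h)))
  · push Not at hex
    refine ⟨fun i => (decide (H 0 i), decide (x (.inr i) < x' (.inr i))), ?_⟩
    intro i j hij
    simp only [Prod.mk.injEq, decide_eq_decide] at hij
    obtain ⟨e0, e1⟩ := hij
    by_contra hne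
    have key : x (.inr i) = x (.inr j) → y (.inr i) = y (.inr j) →
        x (.inr i) ≠ x' (.inr i) → x (.inr j) ≠ x' (.inr j) → False := by
      intro ex ey n1 n2
      refine hD i j hne (Or.inl ⟨ey, ?_⟩)
      rw [ex] at e1 n1 ⊢
      rw [ov_corner]
      grind
    by_cases h0 : H 0 i
    · have h0' := e0.1 h0
      have w1 := hHW _ _ ((hex i).1 h0)
      have w1' := hHW _ _ ((hex j).1 h0')
      exact key (w1.1.symm.trans w1'.1) (h0.1.symm.trans h0'.1) (ov_ne h0.2) (ov_ne h0'.2)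
    · have h0' := fun h => h0 (e0.2 h)
      have w0 := hHW _ _ h0
      have w0' := hHW _ _ h0'
      have h1 := (hex i).2 h0
      have h1' := (hex j).2 h0'
      exact key (w0.1.symm.trans w0'.1) (h1.1.symm.trans h1'.1) (ov_ne h1.2) (ov_ne h1'.2)

lemma LPath_isPath {x y x' y' : ℝ} (h : x ≠ x') (h' : y ≠ y') :
    IsAA1BendPath (LPath x y x' y') := by
  refine Or.inr ⟨(x', y), (x, y), (x, y'), ?_, ?_, Or.inr ⟨rfl, rfl⟩, ?_⟩
  · simpa using h.symm
  · simpa using h'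
  · unfold LPath
    rw [segment_symm ℝ (x', y)]

noncomputable def pathC : Fin 4 → Set (ℝ × ℝ) :=
  ![LPath 1 0 2 1, LPath 1 0 0 (-1), LPath 0 1 1 2, LPath 0 1 (-1) 0]

noncomputable def pathA : Fin 2 → Set (ℝ × ℝ) :=
  ![LPath 0 0 2 2, LPath 1 1 (-1) (-1)]

lemma pathA_ok : ∀ k, IsAA1BendPath (pathA k) := by
  intro k
  fin_cases k <;> simp [pathA] <;> apply LPath_isPath <;> norm_num

lemma pathC_ok : ∀ k, IsAA1BendPath (pathC k) := by
  intro k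
  fin_cases k <;> simp [pathC] <;> apply LPath_isPath <;> norm_num

lemma pathA_A : ∀ k l, k ≠ l → ¬ (pathA k ∩ pathA l).Infinite := by
  intro k l h
  fin_cases k <;> fin_cases l <;> first | exact absurd rfl h | skip
  all_goals simp [-Set.not_infinite, pathA, inter_infinite_s13]

lemma pathC_C : ∀ k l, k ≠ l → ¬ (pathC k ∩ pathC l).Infinite := by
  intro k l h
  fin_cases k <;> fin_cases l <;> first | exact absurd rfl h | skip
  all_goals simp [-Set.not_infinite, pathC, inter_infinite_s13, Ov]

lemma pathA_C : ∀ k l, (pathA k ∩ pathC l).Infinite := by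
  intro k l
  fin_cases k <;> fin_cases l
  all_goals simp [pathA, pathC, inter_infinite_s13, Ov]

/-- The complete bipartite graph `K_{2,s}` admits an axis-aligned 1-bend EPG
representation if and only if `s ≤ 4`. -/
theorem stmt13 (s : ℕ) (hs : 0 < s) :
    (∃ f : Fin 2 ⊕ Fin s → Set (ℝ × ℝ),
      IsAA1BendEPG (completeBipartiteGraph (Fin 2) (Fin s)) f) ↔ s ≤ 4 := by
  constructor
  · rintro ⟨f, hp, hadj⟩
    choose x y x' y' hf using fun v => exists_LPath (hp v)
    simp only [hf, inter_infinite_s13] at hadj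
    apply upper x y x' y'
    · rw [← hadj _ _ (by simp)]
      simp
    · intro k i
      rw [← hadj _ _ (by simp)]
      simp
    · intro i j hij
      rw [← hadj _ _ (by simpa using hij)]
      simp
  · intro h
    refine ⟨Sum.elim pathA (fun i => pathC (Fin.castLE h i)), ?_, ?_⟩
    · rintro (k | i)
      · exact pathA_ok k
      · exact pathC_ok _
    · rintro (k | i) (l | j) hne
      · simpa [-Set.not_infinite] using pathA_A k l (by simpa using hne)
      · simpa using pathA_C k _
      · simpa [Set.inter_comm] using pathA_C l (Fin.castLE h i)
      · simpa [-Set.not_infinite] using pathC_C (Fin.castLE h i) (Fin.castLE h j) (by simpa using hne)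
end
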